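/- There is a commutative diagram of abelian groups with exact rows 0 → M → ℤ(Q) →^{π₁} Wt(Q) → 0 and 0 → M → ℤ^d →^{deg} Cl(X) → 0, whose vertical maps are π₂: ℤ(Q) → ℤ^d and ν: Wt(Q) → Cl(X) (where ν(χ_i) = E_i for i ∈ Q₀), and in which π₂ identifies the subsemigroup ℕ(Q) ∩ ker(π₁) with σ^∨ ∩ M = ℕ^d ∩ ker(deg). In particular, the lattice ℤ(Q) has rank n + r. -/

import Mathlib

namespace NCCell
/-- Toric data for a normal affine toric variety `X = Spec k[σ^∨ ∩ M]` of dimension `n`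
with a torus-invariant point: the strongly convex, full-dimensional rational cone
`σ ⊆ ℝⁿ` is recorded through the primitive generators `v ρ` of its `d` extremal rays. -/
structure ToricData (n d : ℕ) where
  v : Fin d → Fin n → ℤ
  primitive : ∀ ρ, Finset.univ.gcd (fun i => (v ρ i).natAbs) = 1
  strongly_convex : ∃ u : Fin n → ℤ, ∀ ρ, 0 < ∑ i, u i * v ρ i
  full_dim : ∀ u : Fin n → ℤ, (∀ ρ, ∑ i, u i * v ρ i = 0) → u = 0
  extremal_rays : ∀ ρ : Fin d, ∃ u : Fin n → ℤ,
    (∑ i, u i * v ρ i = 0) ∧ ∀ ρ', ρ' ≠ ρ → 0 < ∑ i, u i * v ρ' i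

namespace ToricData
variable {n d : ℕ} (T : ToricData n d)
/-- The inclusion `M = ℤⁿ → ℤᵈ`, `u ↦ (⟨u, v_ρ⟩)_ρ`, from the exact sequence
`0 → M → ℤᵈ → Cl(X) → 0`. -/
def iota : (Fin n → ℤ) →+ (Fin d → ℤ) where
  toFun u := fun ρ => ∑ i, u i * T.v ρ i
  map_zero' := by funext ρ; simp
  map_add' u w := by funext ρ; simp [add_mul, Finset.sum_add_distrib]
/-- The sublattice of `ℤᵈ` of principal torus-invariant Weil divisors, i.e. the image
of `M`; the class group `Cl(X)` is the quotient `ℤᵈ ⧸ prin`. -/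
def prin : AddSubgroup (Fin d → ℤ) := T.iota.range
/-- `X` is Gorenstein: `(1,…,1)` lies in (the image of) `M`. -/
def Gorenstein : Prop := (fun _ => 1 : Fin d → ℤ) ∈ T.prin
end ToricData

def toInt {d : ℕ} (u : Fin d → ℕ) : Fin d → ℤ := fun ρ => (u ρ : ℤ)

/-- A collection of distinct rank one reflexive sheaves on `X`, recorded through Weil
divisor representatives `D i` of their divisor classes. -/
structure Collection {n d : ℕ} (T : ToricData n d) (I : Type*) where
  D : I → Fin d → ℤ
  distinct : ∀ i j : I, D i - D j ∈ T.prin → i = j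

namespace Collection
section
variable {n d : ℕ} {T : ToricData n d} {I : Type*} (C : Collection T I)
/-- `u ∈ ℕᵈ` is (the divisor of zeroes of) a torus-invariant section of
`Hom(E_i, E_j) = H⁰(X, O_X(D_j - D_i))`, i.e. `u` is effective of class `[D_j - D_i]`. -/
def IsSection (i j : I) (u : Fin d → ℕ) : Prop :=
  toInt u - (C.D j - C.D i) ∈ T.prin
/-- A torus-invariant section is irreducible if it admits no nontrivial factorisation
through a member of the collection. -/
def IsIrreducible (i j : I) (u : Fin d → ℕ) : Prop :=
  C.IsSection i j u ∧
    ∀ (l : I) (u₁ u₂ : Fin d → ℕ), u = u₁ + u₂ →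
      C.IsSection i l u₂ → C.IsSection l j u₁ →
      (l = i ∧ u₂ = 0) ∨ (l = j ∧ u₁ = 0)
/-- An arrow of the quiver of sections `Q` of the collection: an irreducible
torus-invariant section, with its head, tail and labelling divisor `div(a) ∈ ℕᵈ`. -/
structure Arrow where
  src : I
  tgt : I
  lab : Fin d → ℕ
  irred : C.IsIrreducible src tgt lab
  nontriv : ¬ (src = tgt ∧ lab = 0)
/-- Paths in the quiver of sections (`nil i` is the trivial path `e_i`, and
`cons p a _` is the path `a·p`, i.e. `a` traversed last). -/
inductive Path : I → I → Type _
  | nil (i : I) : Path i i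
  | cons {i j : I} (p : Path i j) (a : C.Arrow) (h : a.src = j) : Path i a.tgt
end

section
variable {n d : ℕ} {T : ToricData n d} {I : Type*} {C : Collection T I}
/-- The labelling divisor `div(p) ∈ ℕᵈ` of a path. -/
def Path.lab {i : I} : {j : I} → C.Path i j → (Fin d → ℕ)
  | _, .nil _ => 0
  | _, .cons p a _ => Path.lab p + a.lab
/-- Composition of paths: `p.comp q` traverses `p` first, then `q`. -/
def Path.comp {i j : I} (p : C.Path i j) : {l : I} → C.Path j l → C.Path i l
  | _, .nil _ => p
  | _, .cons q a h => .cons (Path.comp p q) a h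
/-- The arrow traversed last by a path. -/
def Path.lastArrow? {i : I} : {j : I} → C.Path i j → Option (C.Arrow)
  | _, .nil _ => none
  | _, .cons _ a _ => some a
/-- The arrow traversed first by a path. -/
def Path.firstArrow? {i : I} : {j : I} → C.Path i j → Option (C.Arrow)
  | _, .nil _ => none
  | _, .cons p a _ => some ((Path.firstArrow? p).getD a)
/-- The list of arrows traversed by a path (last traversed first). -/
def Path.arrows {i : I} : {j : I} → C.Path i j → List (C.Arrow)
  | _, .nil _ => []
  | _, .cons p a _ => a :: Path.arrows p

/-- `pp - pm` is one of the generating relations of the ideal of superpotential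
relations `J_W`: there is a path `q` such that the derivative `∂_q W` of the
superpotential `W = Σ_{p anticanonical cycle} p` is the sum of precisely the two paths
`pp` and `pm`, and these two paths share neither initial nor final arrow.  (Here
`∂_q W` is the sum of all paths `p` with tail at `h(q)`, head at `t(q)` and labelling
monomial `x^{div p} = Π_ρ x_ρ / x^{div q}`.) -/
def IsSPRel {i j : I} (pp pm : C.Path i j) : Prop :=
  ∃ q : C.Path j i,
    (∀ ρ, pp.lab ρ + q.lab ρ = 1) ∧ (∀ ρ, pm.lab ρ + q.lab ρ = 1) ∧
    pp ≠ pm ∧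
    pp.firstArrow? ≠ pm.firstArrow? ∧ pp.lastArrow? ≠ pm.lastArrow? ∧
    (∀ p : C.Path i j, (∀ ρ, p.lab ρ + q.lab ρ = 1) → p = pp ∨ p = pm)

/-- F-term equivalence of paths: the equivalence relation generated by
`q₂ p₊ q₁ ∼ q₂ p₋ q₁` for superpotential relations `p₊ - p₋ ∈ J_W`.  Two paths are
identified in the superpotential algebra `A_W = kQ/J_W` iff they are F-term equivalent. -/
inductive FTermEquiv : {i j : I} → C.Path i j → C.Path i j → Prop
  | rel {i j l m : I} {pp pm : C.Path i j} (q₁ : C.Path l i) (q₂ : C.Path j m)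
      (h : IsSPRel pp pm) :
      FTermEquiv ((q₁.comp pp).comp q₂) ((q₁.comp pm).comp q₂)
  | refl {i j : I} (p : C.Path i j) : FTermEquiv p p
  | symm {i j : I} {p q : C.Path i j} : FTermEquiv p q → FTermEquiv q p
  | trans {i j : I} {p q r : C.Path i j} : FTermEquiv p q → FTermEquiv q r → FTermEquiv p r
end

/-- The toric algebra `A_𝓔 = kQ/J_𝓔` is consistent, i.e. `J_𝓔 = J_W`: since (classes of)
paths form bases of both quotient algebras, this says precisely that two paths of `Q`
with the same head and tail are identified in `A_𝓔` (i.e. share the same labelling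
divisor) if and only if they are identified in `A_W` (i.e. are F-term equivalent). -/
def Consistent {n d : ℕ} {T : ToricData n d} {I : Type*} (C : Collection T I) : Prop :=
  ∀ (i j : I) (p q : C.Path i j), p.lab = q.lab ↔ FTermEquiv p q

end Collection
end NCCell

namespace NCCell
namespace Collection
section
variable {n d : ℕ} {T : ToricData n d} {I : Type*} [DecidableEq I] (C : Collection T I)

/-- The value `π(χ_a) = (χ_{h(a)} - χ_{t(a)}, div a)` of the map
`π = (inc, div) : ℤ^{Q₁} → Wt(Q) ⊕ ℤᵈ` on the characteristic function of an arrow. -/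
def piGen (a : C.Arrow) : (I → ℤ) × (Fin d → ℤ) :=
  (fun i => (if i = a.tgt then 1 else 0) - (if i = a.src then 1 else 0), toInt a.lab)

/-- The lattice `ℤ(Q) = π(ℤ^{Q₁})`, realised as the subgroup of `ℤ^{Q₀} ⊕ ℤᵈ`
generated by the vectors `π(χ_a)`. -/
def latZQ : AddSubgroup ((I → ℤ) × (Fin d → ℤ)) :=
  AddSubgroup.closure (Set.range C.piGen)

/-- The semigroup `ℕ(Q) = π(ℕ^{Q₁})`, realised as the subsemigroup of `ℤ^{Q₀} ⊕ ℤᵈ`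
generated by the vectors `π(χ_a)`. -/
def semiNQ : AddSubmonoid ((I → ℤ) × (Fin d → ℤ)) :=
  AddSubmonoid.closure (Set.range C.piGen)

end
end Collection
end NCCell

namespace NCCell

theorem ToricData.iota_injective {n d : ℕ} (T : ToricData n d) : Function.Injective T.iota :=
  (injective_iff_map_eq_zero T.iota).2 fun u hu => T.full_dim u fun ρ => congrFun hu ρ

/-- Every divisor becomes effective after adding a suitable effective principal divisor. -/
theorem ToricData.exists_iota_nonneg_add_nonneg {n d : ℕ} (T : ToricData n d)
    (w : Fin d → ℤ) :
    ∃ u : Fin n → ℤ, (∀ ρ, 0 ≤ T.iota u ρ) ∧ ∀ ρ, 0 ≤ w ρ + T.iota u ρ := by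
  obtain ⟨u, hu⟩ := T.strongly_convex
  have hu' : ∀ ρ, 0 < T.iota u ρ := hu
  have hN : 0 ≤ ∑ ρ, |w ρ| := Finset.sum_nonneg fun ρ _ => abs_nonneg _
  refine ⟨(∑ ρ, |w ρ|) • u, fun ρ => ?_, fun ρ => ?_⟩
  · rw [map_zsmul, Pi.smul_apply, smul_eq_mul]
    exact mul_nonneg hN (hu' ρ).le
  · have hle : |w ρ| ≤ ∑ ρ, |w ρ| :=
      Finset.single_le_sum (f := fun ρ => |w ρ|) (fun ρ _ => abs_nonneg _) (Finset.mem_univ ρ)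
    have habs := neg_abs_le (w ρ)
    have hmul := le_mul_of_one_le_right hN (Int.add_one_le_iff.2 (hu' ρ))
    rw [map_zsmul, Pi.smul_apply, smul_eq_mul]
    linarith

theorem exists_toInt_eq {d : ℕ} {w : Fin d → ℤ} (hw : ∀ ρ, 0 ≤ w ρ) :
    ∃ u : Fin d → ℕ, toInt u = w :=
  ⟨fun ρ => (w ρ).toNat, funext fun ρ => Int.toNat_of_nonneg (hw ρ)⟩

theorem toInt_zero {d : ℕ} : toInt (0 : Fin d → ℕ) = 0 :=
  funext fun _ => Nat.cast_zero

theorem toInt_add {d : ℕ} (u w : Fin d → ℕ) : toInt (u + w) = toInt u + toInt w :=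
  funext fun _ => Nat.cast_add _ _

namespace Collection

variable {n d : ℕ} {T : ToricData n d} {I : Type*} (C : Collection T I)

theorem eq_of_isSection_zero {i j : I} (h : C.IsSection i j 0) : i = j :=
  C.distinct i j (by simpa [IsSection, toInt_zero] using h)

theorem exists_isSection (i j : I) : ∃ u, C.IsSection i j u := by
  obtain ⟨m, -, hm⟩ := T.exists_iota_nonneg_add_nonneg (C.D j - C.D i)
  obtain ⟨u, hu⟩ := exists_toInt_eq (w := C.D j - C.D i + T.iota m) hm
  exact ⟨u, m, by rw [hu]; abel⟩

variable [DecidableEq I]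

/-- Every torus-invariant section is a product of irreducible ones, so its class lies in the
semigroup generated by the arrows. -/
theorem mem_semiNQ_of_isSection {i j : I} {u : Fin d → ℕ} (h : C.IsSection i j u) :
    (Pi.single j 1 - Pi.single i 1, toInt u) ∈ C.semiNQ := by
  induction hs : ∑ ρ, u ρ using Nat.strong_induction_on generalizing i j u with
  | _ s ih =>
    by_cases htriv : i = j ∧ u = 0
    · obtain ⟨rfl, rfl⟩ := htriv
      rw [sub_self, toInt_zero]
      exact C.semiNQ.zero_mem
    by_cases hirr : C.IsIrreducible i j u
    · refine AddSubmonoid.subset_closure ⟨⟨i, j, u, hirr, htriv⟩, ?_⟩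
      refine Prod.ext (funext fun l => ?_) rfl
      simp [piGen, Pi.single_apply]
    · simp only [IsIrreducible, not_and, not_forall] at hirr
      obtain ⟨l, u₁, u₂, rfl, h₂, h₁, hne⟩ := hirr h
      have pos_sum : ∀ w : Fin d → ℕ, w ≠ 0 → 0 < ∑ ρ, w ρ := fun w hw =>
        Nat.pos_of_ne_zero fun h0 => hw <| funext fun ρ =>
          Finset.sum_eq_zero_iff.1 h0 ρ (Finset.mem_univ ρ)
      have hu₂ : u₂ ≠ 0 := by
        rintro rfl
        exact hne (Or.inl ⟨(C.eq_of_isSection_zero h₂).symm, rfl⟩)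
      have hu₁ : u₁ ≠ 0 := by
        rintro rfl
        exact hne (Or.inr ⟨C.eq_of_isSection_zero h₁, rfl⟩)
      have hpos₁ := pos_sum u₁ hu₁
      have hpos₂ := pos_sum u₂ hu₂
      simp only [Pi.add_apply, Finset.sum_add_distrib] at hs
      have hsum := C.semiNQ.add_mem (ih _ (by omega) h₁ rfl) (ih _ (by omega) h₂ rfl)
      rwa [Prod.mk_add_mk, sub_add_sub_cancel, ← toInt_add] at hsum

theorem semiNQ_le_latZQ : C.semiNQ ≤ C.latZQ.toAddSubmonoid :=
  AddSubmonoid.closure_le.2 AddSubgroup.subset_closure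

theorem zero_mk_mem_semiNQ [Nonempty I] {w : Fin d → ℤ} (hw : ∀ ρ, 0 ≤ w ρ)
    (hp : w ∈ T.prin) : ((0 : I → ℤ), w) ∈ C.semiNQ := by
  obtain ⟨i⟩ := ‹Nonempty I›
  obtain ⟨u, rfl⟩ := exists_toInt_eq hw
  simpa using C.mem_semiNQ_of_isSection (i := i) (j := i) (u := u) (by simpa [IsSection] using hp)

theorem zero_iota_mem_latZQ [Nonempty I] (u : Fin n → ℤ) :
    ((0 : I → ℤ), T.iota u) ∈ C.latZQ := by
  obtain ⟨m, hm, hum⟩ := T.exists_iota_nonneg_add_nonneg (T.iota u)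
  have h₁ := C.semiNQ_le_latZQ
    (C.zero_mk_mem_semiNQ (w := T.iota (u + m)) (by simpa using hum) ⟨_, rfl⟩)
  have h₂ := C.semiNQ_le_latZQ (C.zero_mk_mem_semiNQ hm ⟨_, rfl⟩)
  simpa using C.latZQ.sub_mem h₁ h₂

theorem snd_nonneg_of_mem_semiNQ {z : (I → ℤ) × (Fin d → ℤ)} (hz : z ∈ C.semiNQ) (ρ : Fin d) :
    0 ≤ z.2 ρ := by
  induction hz using AddSubmonoid.closure_induction with
  | mem z hz =>
    obtain ⟨a, rfl⟩ := hz
    exact Int.natCast_nonneg _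
  | zero => exact le_rfl
  | add x y _ _ hx hy => exact add_nonneg hx hy

variable [Fintype I]

theorem sum_fst_of_mem_latZQ {z : (I → ℤ) × (Fin d → ℤ)} (hz : z ∈ C.latZQ) :
    ∑ i, z.1 i = 0 := by
  induction hz using AddSubgroup.closure_induction with
  | mem z hz =>
    obtain ⟨a, rfl⟩ := hz
    simp [piGen]
  | zero => simp
  | add x y _ _ hx hy => simp [Finset.sum_add_distrib, hx, hy]
  | neg x _ hx => simp [hx]

theorem sub_sum_mem_prin_of_mem_latZQ {z : (I → ℤ) × (Fin d → ℤ)} (hz : z ∈ C.latZQ) :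
    z.2 - ∑ i, z.1 i • C.D i ∈ T.prin := by
  induction hz using AddSubgroup.closure_induction with
  | mem z hz =>
    obtain ⟨a, rfl⟩ := hz
    simpa [piGen, sub_smul, Finset.sum_sub_distrib, IsSection] using a.irred.1
  | zero => simp
  | add x y _ _ hx hy =>
    convert T.prin.add_mem hx hy using 1
    simp only [Prod.fst_add, Prod.snd_add, Pi.add_apply, add_smul, Finset.sum_add_distrib]
    abel
  | neg x _ hx =>
    convert T.prin.neg_mem hx using 1
    simp only [Prod.fst_neg, Prod.snd_neg, Pi.neg_apply, neg_smul, Finset.sum_neg_distrib]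
    abel

theorem exists_mem_latZQ_fst_eq [Nonempty I] {θ : I → ℤ} (hθ : ∑ i, θ i = 0) :
    ∃ z ∈ C.latZQ, z.1 = θ := by
  obtain ⟨o⟩ := ‹Nonempty I›
  choose u hu using C.exists_isSection o
  refine ⟨∑ i, θ i • (Pi.single i 1 - Pi.single o 1, toInt (u i)),
    C.latZQ.sum_mem fun i _ => C.latZQ.zsmul_mem
      (C.semiNQ_le_latZQ (C.mem_semiNQ_of_isSection (hu i))) _, funext fun l => ?_⟩
  simp only [Prod.fst_sum, Prod.smul_fst, Finset.sum_apply, Pi.smul_apply, Pi.sub_apply, smul_sub,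
    Finset.sum_sub_distrib, ← Finset.sum_smul, hθ]
  simp [Pi.single_apply]

theorem mem_latZQ_iff [Nonempty I] {z : (I → ℤ) × (Fin d → ℤ)} :
    z ∈ C.latZQ ↔ ∑ i, z.1 i = 0 ∧ z.2 - ∑ i, z.1 i • C.D i ∈ T.prin := by
  refine ⟨fun hz => ⟨C.sum_fst_of_mem_latZQ hz, C.sub_sum_mem_prin_of_mem_latZQ hz⟩, ?_⟩
  rintro ⟨hsum, hprin⟩
  obtain ⟨y, hy, hyz⟩ := C.exists_mem_latZQ_fst_eq hsum
  have hyp := C.sub_sum_mem_prin_of_mem_latZQ hy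
  rw [hyz] at hyp
  obtain ⟨u, hu⟩ := T.prin.sub_mem hprin hyp
  rw [sub_sub_sub_cancel_right] at hu
  have hz : z = (0, T.iota u) + y := Prod.ext (by simp [hyz]) (by simp [hu])
  rw [hz]
  exact C.latZQ.add_mem (C.zero_iota_mem_latZQ u) hy

theorem zero_mk_mem_semiNQ_iff [Nonempty I] {w : Fin d → ℤ} :
    ((0 : I → ℤ), w) ∈ C.semiNQ ↔ (∀ ρ, 0 ≤ w ρ) ∧ w ∈ T.prin :=
  ⟨fun h => ⟨C.snd_nonneg_of_mem_semiNQ h,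
    by simpa using C.sub_sum_mem_prin_of_mem_latZQ (C.semiNQ_le_latZQ h)⟩,
    fun h => C.zero_mk_mem_semiNQ h.1 h.2⟩

end Collection

/-- The parametrisation of weights of total zero by their coordinates away from `0`. -/
def weightOfTail (r : ℕ) : (Fin r → ℤ) →ₗ[ℤ] (Fin (r + 1) → ℤ) where
  toFun t := Fin.cons (-∑ i, t i) t
  map_add' s t := by
    funext i
    refine Fin.cases ?_ (fun j => ?_) i
    · simp only [Fin.cons_zero, Pi.add_apply, Finset.sum_add_distrib]; abel
    · simp
  map_smul' c t := by
    funext i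
    refine Fin.cases ?_ (fun j => ?_) i
    · simp [Finset.mul_sum]
    · simp

theorem sum_weightOfTail {r : ℕ} (t : Fin r → ℤ) : ∑ i, weightOfTail r t i = 0 := by
  simp [weightOfTail, Fin.sum_univ_succ]

theorem weightOfTail_injective (r : ℕ) : Function.Injective (weightOfTail r) := fun s t h =>
  funext fun i => by simpa [weightOfTail] using congrFun h i.succ

theorem weightOfTail_tail {r : ℕ} {θ : Fin (r + 1) → ℤ} (hθ : ∑ i, θ i = 0) :
    weightOfTail r (Fin.tail θ) = θ := by
  rw [Fin.sum_univ_succ] at hθ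
  funext i
  refine Fin.cases ?_ (fun j => ?_) i
  · simp only [weightOfTail, LinearMap.coe_mk, AddHom.coe_mk, Fin.cons_zero, Fin.tail]
    linarith
  · simp [weightOfTail, Fin.tail]

theorem Collection.rank_latZQ {n d r : ℕ} {T : ToricData n d} (C : Collection T (Fin (r + 1))) :
    Module.rank ℤ ↥(AddSubgroup.toIntSubmodule C.latZQ) = ((n + r : ℕ) : Cardinal) := by
  let ι := T.iota.toIntLinearMap
  let θ := (weightOfTail r).comp (LinearMap.snd ℤ (Fin n → ℤ) (Fin r → ℤ))
  let ν := Fintype.linearCombination ℤ C.D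
  let f := θ.prod (ι.comp (LinearMap.fst ℤ (Fin n → ℤ) (Fin r → ℤ)) + ν.comp θ)
  have hf : ∀ x, f x = (weightOfTail r x.2,
      T.iota x.1 + ∑ i, weightOfTail r x.2 i • C.D i) := fun x => rfl
  have hinj : Function.Injective f := by
    rintro ⟨u, s⟩ ⟨w, t⟩ h
    rw [hf, hf, Prod.mk.injEq] at h
    obtain rfl := weightOfTail_injective r h.1
    exact Prod.ext (T.iota_injective (add_right_cancel h.2)) rfl
  have hrange : LinearMap.range f = AddSubgroup.toIntSubmodule C.latZQ := by
    ext z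
    change _ ↔ z ∈ C.latZQ
    rw [C.mem_latZQ_iff]
    constructor
    · rintro ⟨x, rfl⟩
      rw [hf]
      exact ⟨sum_weightOfTail x.2, x.1, (add_sub_cancel_right _ _).symm⟩
    · rintro ⟨hsum, u, hu⟩
      refine ⟨(u, Fin.tail z.1), ?_⟩
      rw [hf, weightOfTail_tail hsum, hu, sub_add_cancel]
  rw [← hrange, rank_range_of_injective f hinj, rank_prod', rank_fin_fun, rank_fin_fun]
  push_cast
  rfl

end NCCell

open NCCell Collection

/-- Lemma 2.9: the commutative diagram with exact rows
`0 → M → ℤ(Q) → Wt(Q) → 0` and `0 → M → ℤᵈ → Cl(X) → 0`, with vertical maps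
`π₂ : ℤ(Q) → ℤᵈ` (second projection) and `ν : Wt(Q) → Cl(X)`, `ν(χ_i) = E_i`; the map
`π₂` identifies `ℕ(Q) ∩ ker π₁` with `σ^∨ ∩ M = ℕᵈ ∩ ker(deg)`; and `ℤ(Q)` has rank
`n + r`.  Here `M → ℤ(Q)` is `u ↦ (0, ι u)`, `π₁` is the first projection, and
`Cl(X) = ℤᵈ ⧸ ι(M)`. -/
theorem latZQ_diagram
    {n d : ℕ} (T : ToricData n d) {r : ℕ}
    (C : Collection T (Fin (r + 1))) (hD₀ : C.D 0 = 0) :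
    -- bottom row exactness at `ℤᵈ` is definitional; `M → ℤᵈ` is injective:
    Function.Injective T.iota
    -- the map `M → ℤ(Q)`, `u ↦ (0, ι u)`, is well defined and injective:
    ∧ (∀ u : Fin n → ℤ, ((0 : Fin (r + 1) → ℤ), T.iota u) ∈ C.latZQ)
    ∧ Function.Injective (fun u : Fin n → ℤ => ((0 : Fin (r + 1) → ℤ), T.iota u))
    -- exactness of the top row at `ℤ(Q)`: `ker π₁ = image of M`:
    ∧ (∀ z ∈ C.latZQ, z.1 = 0 ↔ ∃ u : Fin n → ℤ, z = (0, T.iota u))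
    -- `π₁` maps `ℤ(Q)` into `Wt(Q)` and onto it (exactness at `Wt(Q)`):
    ∧ (∀ z ∈ C.latZQ, ∑ i, z.1 i = 0)
    ∧ (∀ θ : Fin (r + 1) → ℤ, ∑ i, θ i = 0 → ∃ z ∈ C.latZQ, z.1 = θ)
    -- commutativity of the square: `deg ∘ π₂ = ν ∘ π₁` in `Cl(X) = ℤᵈ ⧸ ι(M)`:
    ∧ (∀ z ∈ C.latZQ, z.2 - (∑ i, z.1 i • C.D i) ∈ T.prin)
    -- `π₂` identifies `ℕ(Q) ∩ ker π₁` with `σ^∨ ∩ M = ℕᵈ ∩ ker(deg)`: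
    ∧ (∀ w : Fin d → ℤ, (((0 : Fin (r + 1) → ℤ), w) ∈ C.semiNQ)
        ↔ ((∀ ρ, 0 ≤ w ρ) ∧ w ∈ T.prin))
    -- the lattice `ℤ(Q)` has rank `n + r`:
    ∧ Module.rank ℤ ↥(AddSubgroup.toIntSubmodule C.latZQ) = ((n + r : ℕ) : Cardinal) := by
  refine ⟨T.iota_injective, C.zero_iota_mem_latZQ,
    fun u w h => T.iota_injective (Prod.mk.inj h).2, fun z hz => ⟨fun h => ?_, ?_⟩,
    fun z => C.sum_fst_of_mem_latZQ, fun θ => C.exists_mem_latZQ_fst_eq,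
    fun z => C.sub_sum_mem_prin_of_mem_latZQ, fun w => C.zero_mk_mem_semiNQ_iff, C.rank_latZQ⟩
  · obtain ⟨u, hu⟩ := C.sub_sum_mem_prin_of_mem_latZQ hz
    exact ⟨u, Prod.ext h (by simp [hu, h])⟩
  · rintro ⟨u, rfl⟩
    rfl
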